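/- Let k be an algebraically closed field of characteristic zero, V~ a finite-dimensional k-vector space, G a finite subgroup of GL(V~) containing no reflection (no finite-order element whose fixed-point subspace is a hyperplane), and W a finite group acting faithfully on the invariant algebra k[V~]^G by graded k-algebra automorphisms. Then there exists a subgroup W~ of GL(V~) containing G as a normal subgroup, together with an isomorphism W~/G ≅ W, such that the natural action of W~/G on k[V~]^G corresponds under this isomorphism to the given action of W. -/

import Mathlib

open MvPolynomial

noncomputable section

namespace ReflQuot

variable {k : Type} [Field k]

/-- The action of an invertible matrix `g` on polynomial functions on `k^n`:
the linear form `X i` is sent to `∑ j, (g⁻¹) i j • X j`, so that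
`(g • f) (v) = f (g⁻¹ ⬝ v)`. -/
def matAct {n : ℕ} (g : Matrix.GeneralLinearGroup (Fin n) k) :
    MvPolynomial (Fin n) k →ₐ[k] MvPolynomial (Fin n) k :=
  aeval fun i => ∑ j, ((↑(g⁻¹) : Matrix (Fin n) (Fin n) k) i j) • X j

/-- The algebra endomorphism of `k[X_1,…,X_m]` sending `X i` to `∑ j, M i j • X j`. -/
def polyAct {m : ℕ} (M : Fin m → Fin m → k) :
    MvPolynomial (Fin m) k →ₐ[k] MvPolynomial (Fin m) k :=
  aeval fun i => ∑ j, M i j • X j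

/-- A reflection: an automorphism of finite order whose fixed-point subspace is a
hyperplane. -/
def IsReflection {n : ℕ} (M : Matrix (Fin n) (Fin n) k) : Prop :=
  IsOfFinOrder M ∧
    Module.finrank k (LinearMap.ker (Matrix.toLin' M - LinearMap.id)) + 1 = n

/-- A double reflection: finite order, fixed points of codimension 2. -/
def IsDoubleReflection {n : ℕ} (M : Matrix (Fin n) (Fin n) k) : Prop :=
  IsOfFinOrder M ∧
    Module.finrank k (LinearMap.ker (Matrix.toLin' M - LinearMap.id)) + 2 = n

/-- A reflection group: a group generated by its reflections. -/
def IsReflectionGroup {n : ℕ} (W : Subgroup (Matrix.GeneralLinearGroup (Fin n) k)) : Prop :=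
  Subgroup.closure {g | g ∈ W ∧ IsReflection ((g : Matrix (Fin n) (Fin n) k))} = W

/-- The algebra of `G`-invariant polynomials. -/
def invariants {n : ℕ} (G : Subgroup (Matrix.GeneralLinearGroup (Fin n) k)) :
    Subalgebra k (MvPolynomial (Fin n) k) where
  carrier := {f | ∀ g ∈ G, matAct g f = f}
  mul_mem' := fun {a b} ha hb g hg => by
    rw [map_mul, ha g hg, hb g hg]
  one_mem' := fun g _ => map_one (matAct g)
  add_mem' := fun {a b} ha hb g hg => by
    rw [map_add, ha g hg, hb g hg]
  zero_mem' := fun g _ => map_zero (matAct g)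
  algebraMap_mem' := fun r g _ => (matAct g).commutes r

/-- The linear span of products of two positive-degree invariants, i.e. `(B^G_+)^2`. -/
def sqSpan {n : ℕ} (G : Subgroup (Matrix.GeneralLinearGroup (Fin n) k)) :
    Submodule k (MvPolynomial (Fin n) k) :=
  Submodule.span k {f | ∃ u ∈ invariants G, ∃ v ∈ invariants G,
    constantCoeff u = 0 ∧ constantCoeff v = 0 ∧ f = u * v}

/-- The ideal of positive-degree elements of the polynomial ring. -/
def idealPlus (k : Type) [Field k] (m : ℕ) : Ideal (MvPolynomial (Fin m) k) :=
  Ideal.span (Set.range X)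

/-- The ideal `I` of relations between the generators `p i` of the invariant algebra:
the kernel of `k[V] = k[X_1,…,X_m] → B^G`, `X i ↦ p i`. -/
def relIdeal {n m : ℕ} (p : Fin m → MvPolynomial (Fin n) k) :
    Ideal (MvPolynomial (Fin m) k) :=
  RingHom.ker (aeval p : MvPolynomial (Fin m) k →ₐ[k] MvPolynomial (Fin n) k)

/-- The context: `Wt` is a finite reflection group on `k^n`, `G` a normal subgroup of `Wt`,
`p` a minimal system of homogeneous generators (of degrees `d`) of the invariant algebra
`B^G` whose span is `Wt`-stable (i.e. a graded `W`-equivariant section of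
`B^G_+ → B^G_+/(B^G_+)^2`), and `c w` the matrix of the action of `w` on the span of the
`p i`, giving the induced action of `W = Wt/G` on `V = k^m`. -/
structure QuotSetup {n m : ℕ} (Wt G : Subgroup (Matrix.GeneralLinearGroup (Fin n) k))
    (p : Fin m → MvPolynomial (Fin n) k) (d : Fin m → ℕ)
    (c : ↥Wt → Fin m → Fin m → k) : Prop where
  finite : (Wt : Set (Matrix.GeneralLinearGroup (Fin n) k)).Finite
  reflGroup : IsReflectionGroup Wt
  le : G ≤ Wt
  normal : ∀ w ∈ Wt, ∀ g ∈ G, w * g * w⁻¹ ∈ G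
  homog : ∀ i, (p i).IsHomogeneous (d i)
  dpos : ∀ i, 0 < d i
  gen : Algebra.adjoin k (Set.range p) = invariants G
  minimal : ∀ a : Fin m → k, (∑ i, a i • p i) ∈ sqSpan G → a = 0
  equivar : ∀ (w : ↥Wt) (i), matAct (w : Matrix.GeneralLinearGroup (Fin n) k) (p i)
      = ∑ j, c w i j • p j

/-- `W = Wt/G` acts trivially on the conormal module `I/(A_+ I)`. -/
def TrivialConormal {n m : ℕ} (Wt : Subgroup (Matrix.GeneralLinearGroup (Fin n) k))
    (p : Fin m → MvPolynomial (Fin n) k) (c : ↥Wt → Fin m → Fin m → k) : Prop :=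
  ∀ w : ↥Wt, ∀ f ∈ relIdeal p, polyAct (c w) f - f ∈ idealPlus k m * relIdeal p

/-- `G` is of complete intersection: `I` is generated by `dim V - dim Vt = m - n` elements. -/
def IsCompleteIntersection {n m : ℕ} (p : Fin m → MvPolynomial (Fin n) k) : Prop :=
  ∃ s : Finset (MvPolynomial (Fin m) k), s.card = m - n ∧ Ideal.span (s : Set _) = relIdeal p

/-- `G` is a good normal subgroup of `Wt`. -/
def IsGoodQuot {n m : ℕ} (Wt : Subgroup (Matrix.GeneralLinearGroup (Fin n) k))
    (p : Fin m → MvPolynomial (Fin n) k) (c : ↥Wt → Fin m → Fin m → k) : Prop :=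
  IsCompleteIntersection p ∧ TrivialConormal Wt p c

/-- The pointwise stabilizer of a subspace `L` in `GL_n(k)`. -/
def pointStab {n : ℕ} (L : Submodule k (Fin n → k)) :
    Subgroup (Matrix.GeneralLinearGroup (Fin n) k) where
  carrier := {g | ∀ x ∈ L, Matrix.mulVec (g : Matrix (Fin n) (Fin n) k) x = x}
  one_mem' := fun x _ => Matrix.one_mulVec x
  mul_mem' := fun {a b} ha hb x hx => by
    rw [Units.val_mul, ← Matrix.mulVec_mulVec, hb x hx, ha x hx]
  inv_mem' := fun {a} ha x hx => by
    have h1 : Matrix.mulVec (↑(a⁻¹) : Matrix (Fin n) (Fin n) k)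
        (Matrix.mulVec (↑a : Matrix (Fin n) (Fin n) k) x) = x := by
      rw [Matrix.mulVec_mulVec, ← Units.val_mul, inv_mul_cancel, Units.val_one,
        Matrix.one_mulVec]
    rw [ha x hx] at h1
    exact h1

/-- The set of reflecting hyperplanes of a subgroup `W` of `GL_n(k)`. -/
def reflHyps {n : ℕ} (W : Subgroup (Matrix.GeneralLinearGroup (Fin n) k)) :
    Set (Submodule k (Fin n → k)) :=
  {H | ∃ g ∈ W, IsReflection ((g : Matrix (Fin n) (Fin n) k)) ∧
      H = LinearMap.ker (Matrix.toLin' ((g : Matrix (Fin n) (Fin n) k)) - LinearMap.id)}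

/-- The set `A'(Wt)` of reflecting hyperplanes `H` of `Wt` such that `Wt_H ≠ G_H`. -/
def reflHyps' {n : ℕ} (Wt G : Subgroup (Matrix.GeneralLinearGroup (Fin n) k)) :
    Set (Submodule k (Fin n → k)) :=
  {H | H ∈ reflHyps Wt ∧ ¬ (Wt ⊓ pointStab H ≤ G)}

/-- `Wt_H` and `Wt_{H'}` have the same image in `W = Wt/G`. -/
def imageEq {n : ℕ} (Wt G : Subgroup (Matrix.GeneralLinearGroup (Fin n) k))
    (H H' : Submodule k (Fin n → k)) : Prop :=
  {x | ∃ g ∈ G, ∃ u ∈ Wt ⊓ pointStab H, x = g * u}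
    = {x | ∃ g ∈ G, ∃ u ∈ Wt ⊓ pointStab H', x = g * u}

/-- `e_H = |G_H|`. -/
def eH {n : ℕ} (G : Subgroup (Matrix.GeneralLinearGroup (Fin n) k))
    (H : Submodule k (Fin n → k)) : ℕ :=
  Nat.card ↥(G ⊓ pointStab H)

/-- The map `p : Vt → V`, `x ↦ (p 1 (x), …, p m (x))`. -/
def pMap {n m : ℕ} (p : Fin m → MvPolynomial (Fin n) k) (x : Fin n → k) : Fin m → k :=
  fun i => eval x (p i)

/-- The matrix of the action of (the image in `W` of) `w` on `V = k^m`. -/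
def qMat {n m : ℕ} {Wt : Subgroup (Matrix.GeneralLinearGroup (Fin n) k)}
    (c : ↥Wt → Fin m → Fin m → k) (w : ↥Wt) : Matrix (Fin m) (Fin m) k :=
  Matrix.of (c w⁻¹)

/-- The set of reflecting hyperplanes of `W = Wt/G` acting on `V = k^m`. -/
def reflHypsV {n m : ℕ} {Wt : Subgroup (Matrix.GeneralLinearGroup (Fin n) k)}
    (c : ↥Wt → Fin m → Fin m → k) : Set (Submodule k (Fin m → k)) :=
  {K | ∃ w : ↥Wt, IsReflection (qMat c w) ∧
      K = LinearMap.ker (Matrix.toLin' (qMat c w) - LinearMap.id)}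

/-- The underlying matrix of an element of a subgroup of `GL_n(k)`. -/
def matOf {n : ℕ} {Wt : Subgroup (Matrix.GeneralLinearGroup (Fin n) k)} (w : ↥Wt) :
    Matrix (Fin n) (Fin n) k :=
  ((w : Matrix.GeneralLinearGroup (Fin n) k) : Matrix (Fin n) (Fin n) k)

section LinearAction

variable {n : ℕ}

/-- The linear form with coefficient vector `v`. -/
def linForm : (Fin n → k) →ₗ[k] MvPolynomial (Fin n) k :=
  Fintype.linearCombination k X

theorem linForm_apply (v : Fin n → k) : linForm v = ∑ i, v i • (X i : MvPolynomial (Fin n) k) :=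
  rfl

theorem linForm_single (i : Fin n) : linForm (Pi.single i (1 : k)) = X i := by
  classical
  simp [linForm_apply, Pi.single_apply]

theorem coeff_linForm (v : Fin n → k) (i : Fin n) :
    coeff (Finsupp.single i 1) (linForm v) = v i := by
  classical
  simp [linForm_apply, coeff_sum, coeff_X, Finsupp.single_left_inj]

theorem linForm_injective : Function.Injective (linForm : (Fin n → k) → _) := fun v w h => by
  ext i
  rw [← coeff_linForm v i, h, coeff_linForm]

theorem isHomogeneous_linForm (v : Fin n → k) : (linForm v).IsHomogeneous 1 :=
  IsHomogeneous.sum _ _ _ fun i _ => (homogeneousSubmodule (Fin n) k 1).smul_mem _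
    (isHomogeneous_X k i)

theorem matAct_X (g : Matrix.GeneralLinearGroup (Fin n) k) (i : Fin n) :
    matAct g (X i) = linForm ((↑(g⁻¹) : Matrix (Fin n) (Fin n) k) i) := by
  simp [matAct, linForm_apply]

theorem matAct_linForm (g : Matrix.GeneralLinearGroup (Fin n) k) (v : Fin n → k) :
    matAct g (linForm v) = linForm (Matrix.vecMul v (↑(g⁻¹) : Matrix (Fin n) (Fin n) k)) := by
  rw [linForm_apply, map_sum, Matrix.vecMul_eq_sum, map_sum]
  exact Finset.sum_congr rfl fun i _ => by rw [map_smul, matAct_X, ← map_smul]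

theorem matAct_one : matAct (1 : Matrix.GeneralLinearGroup (Fin n) k) = AlgHom.id k _ := by
  refine MvPolynomial.algHom_ext fun i => ?_
  rw [← linForm_single, matAct_linForm]
  simp

theorem matAct_mul (g h : Matrix.GeneralLinearGroup (Fin n) k) (f : MvPolynomial (Fin n) k) :
    matAct (g * h) f = matAct g (matAct h f) := by
  have : matAct (g * h) = (matAct g).comp (matAct h) := by
    refine MvPolynomial.algHom_ext fun i => ?_
    rw [AlgHom.comp_apply, ← linForm_single, matAct_linForm, matAct_linForm, matAct_linForm,
      mul_inv_rev, Units.val_mul, Matrix.vecMul_vecMul]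
  rw [this, AlgHom.comp_apply]

theorem eq_of_matAct_linForm_eq {g h : Matrix.GeneralLinearGroup (Fin n) k}
    (H : ∀ v, matAct g (linForm v) = matAct h (linForm v)) : g = h := by
  have : (↑(g⁻¹) : Matrix (Fin n) (Fin n) k) = ↑(h⁻¹) := by
    refine Matrix.ext_of_single_vecMul fun i => linForm_injective ?_
    rw [← matAct_linForm, ← matAct_linForm, H]
  exact inv_injective (Units.ext this)

theorem isHomogeneous_matAct (g : Matrix.GeneralLinearGroup (Fin n) k)
    {f : MvPolynomial (Fin n) k} {d : ℕ} (hf : f.IsHomogeneous d) :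
    (matAct g f).IsHomogeneous d := by
  have := hf.aeval (fun i => matAct g (X i)) (n := 1)
    fun i => by rw [matAct_X]; exact isHomogeneous_linForm _
  rw [one_mul] at this
  convert this using 1
  simp [matAct]

theorem homogeneousComponent_matAct (g : Matrix.GeneralLinearGroup (Fin n) k)
    (f : MvPolynomial (Fin n) k) (d : ℕ) :
    homogeneousComponent d (matAct g f) = matAct g (homogeneousComponent d f) := by
  conv_lhs => rw [← sum_homogeneousComponent f]
  rw [map_sum, map_sum]
  have h (i : ℕ) : homogeneousComponent d (matAct g (homogeneousComponent i f))
      = if d = i then matAct g (homogeneousComponent i f) else 0 :=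
    homogeneousComponent_of_mem
      (isHomogeneous_matAct g (homogeneousComponent_isHomogeneous i f))
  simp_rw [h]
  rw [Finset.sum_ite_eq]
  split_ifs with hd
  · rfl
  · rw [homogeneousComponent_eq_zero, map_zero]
    simpa [Nat.lt_succ_iff] using hd

theorem homogeneousComponent_mem_invariants {G : Subgroup (Matrix.GeneralLinearGroup (Fin n) k)}
    {f : MvPolynomial (Fin n) k} (hf : f ∈ invariants G) (d : ℕ) :
    homogeneousComponent d f ∈ invariants G := fun g hg => by
  rw [← homogeneousComponent_matAct, hf g hg]

end LinearAction

section Inertia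

variable {n : ℕ}

theorem exists_eq_smul_of_dvd_linForm {p : MvPolynomial (Fin n) k} (hp : ¬ IsUnit p)
    {w₀ w : Fin n → k} (hw₀ : w₀ ≠ 0) (h₀ : p ∣ linForm w₀) (h : p ∣ linForm w) :
    ∃ c : k, c • w₀ = w := by
  rcases eq_or_ne w 0 with rfl | hw
  · exact ⟨0, zero_smul _ _⟩
  have key : ∀ {u : Fin n → k}, u ≠ 0 → p ∣ linForm u →
      ∃ r : k, r ≠ 0 ∧ linForm u = r • p := by
    rintro u hu ⟨q, hq⟩
    have hu' : linForm u ≠ 0 := by simpa using linForm_injective.ne hu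
    have hp0 : p ≠ 0 := by rintro rfl; exact hu' (by rw [hq, zero_mul])
    have hq0 : q ≠ 0 := by rintro rfl; exact hu' (by rw [hq, mul_zero])
    have hdeg := (isHomogeneous_linForm u).totalDegree hu'
    rw [hq, totalDegree_mul_of_isDomain hp0 hq0] at hdeg
    have hpd : p.totalDegree ≠ 0 := fun hd => by
      rw [totalDegree_eq_zero_iff_eq_C] at hd
      refine hp ?_
      rw [hd]
      refine (IsUnit.mk0 (coeff 0 p) fun h0 => hp0 ?_).map C
      rw [hd, h0, map_zero]
    have hqd : q = C (coeff 0 q) := totalDegree_eq_zero_iff_eq_C.mp (by omega)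
    refine ⟨coeff 0 q, fun h0 => hq0 ?_, ?_⟩
    · rw [hqd, h0, map_zero]
    · rw [smul_eq_C_mul, ← hqd, hq, mul_comm]
  obtain ⟨r₀, hr₀, e₀⟩ := key hw₀ h₀
  obtain ⟨r, -, e⟩ := key hw h
  refine ⟨r * r₀⁻¹, linForm_injective ?_⟩
  rw [map_smul, e₀, e, smul_smul, inv_mul_cancel_right₀ hr₀]

/-- An element of finite order acting trivially modulo a non-unit is trivial or a reflection. -/
theorem exists_not_dvd_sub_matAct {g : Matrix.GeneralLinearGroup (Fin n) k} (hg : g ≠ 1)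
    (hfin : IsOfFinOrder ((↑(g⁻¹) : Matrix (Fin n) (Fin n) k)))
    (hrefl : ¬ IsReflection ((↑(g⁻¹) : Matrix (Fin n) (Fin n) k)))
    {p : MvPolynomial (Fin n) k} (hp : ¬ IsUnit p) :
    ∃ v, ¬ p ∣ linForm v - matAct g (linForm v) := by
  by_contra! H
  set N : Matrix (Fin n) (Fin n) k := ↑(g⁻¹) - 1 with hN
  have hmat (v : Fin n → k) : matAct g (linForm v) - linForm v = linForm (Matrix.vecMul v N) := by
    rw [matAct_linForm, hN, Matrix.vecMul_sub, Matrix.vecMul_one, map_sub]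
  have hdvd (v : Fin n → k) : p ∣ linForm (Matrix.vecMul v N) := by
    rw [← hmat, dvd_sub_comm]
    exact H v
  obtain ⟨v₀, hv₀⟩ : ∃ v, Matrix.vecMul v N ≠ 0 := by
    by_contra! h
    refine hg (eq_of_matAct_linForm_eq fun v => ?_)
    rw [← sub_eq_zero, matAct_one, AlgHom.id_apply, hmat, h, map_zero]
  have hrank : Module.finrank k (LinearMap.range (Matrix.mulVecLin N.transpose)) = 1 := by
    refine finrank_eq_one ⟨_, v₀, rfl⟩ ?_ ?_
    · exact fun h => hv₀ (by simpa [Matrix.mulVec_transpose] using congrArg Subtype.val h)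
    · rintro ⟨_, v, rfl⟩
      obtain ⟨c, hc⟩ := exists_eq_smul_of_dvd_linForm hp hv₀ (hdvd v₀) (hdvd v)
      refine ⟨c, Subtype.ext ?_⟩
      simpa [Matrix.mulVec_transpose] using hc
  refine hrefl ⟨hfin, ?_⟩
  have h1 : N.rank = 1 := by rw [← Matrix.rank_transpose]; exact hrank
  have h2 := LinearMap.finrank_range_add_finrank_ker N.mulVecLin
  rw [Module.finrank_fin_fun] at h2
  have h3 : Matrix.toLin' ((↑(g⁻¹) : Matrix (Fin n) (Fin n) k)) - LinearMap.id = N.mulVecLin := by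
    ext; simp [hN]
  rw [h3]
  rw [Matrix.rank] at h1
  omega

end Inertia

section Orbit

variable {n : ℕ} (G : Subgroup (Matrix.GeneralLinearGroup (Fin n) k)) [Fintype G]

/-- The monic polynomial whose roots are the translates of `u` under `G`. -/
def orbitPoly (u : MvPolynomial (Fin n) k) : Polynomial (MvPolynomial (Fin n) k) :=
  ∏ g : G, (Polynomial.X - Polynomial.C (matAct (g : Matrix.GeneralLinearGroup (Fin n) k) u))

theorem orbitPoly_monic (u : MvPolynomial (Fin n) k) : (orbitPoly G u).Monic :=
  Polynomial.monic_prod_of_monic _ _ fun _ _ => Polynomial.monic_X_sub_C _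

theorem orbitPoly_coeff_mem (u : MvPolynomial (Fin n) k) (i : ℕ) :
    (orbitPoly G u).coeff i ∈ invariants G := fun h hh => by
  have : (orbitPoly G u).map (matAct h : _ →+* _) = orbitPoly G u := by
    simp only [orbitPoly, Polynomial.map_prod, Polynomial.map_sub, Polynomial.map_X,
      Polynomial.map_C, RingHom.coe_coe, ← matAct_mul]
    exact Fintype.prod_equiv (Equiv.mulLeft (⟨h, hh⟩ : G)) _ _ fun g => rfl
  conv_rhs => rw [← this, Polynomial.coeff_map]
  rfl

theorem orbitPoly_eq [DecidableEq G] (u : MvPolynomial (Fin n) k) :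
    orbitPoly G u = (Polynomial.X - Polynomial.C u) * ∏ g ∈ Finset.univ.erase (1 : G),
      (Polynomial.X - Polynomial.C (matAct (g : Matrix.GeneralLinearGroup (Fin n) k) u)) := by
  rw [orbitPoly, ← Finset.mul_prod_erase _ _ (Finset.mem_univ (1 : G)), Subgroup.coe_one,
    matAct_one, AlgHom.id_apply]

theorem orbitPoly_eval (u : MvPolynomial (Fin n) k) : (orbitPoly G u).eval u = 0 := by
  classical
  simp [orbitPoly_eq]

theorem orbitPoly_derivative_eval [DecidableEq G] (u : MvPolynomial (Fin n) k) :
    (orbitPoly G u).derivative.eval u = ∏ g ∈ Finset.univ.erase (1 : G),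
      (u - matAct (g : Matrix.GeneralLinearGroup (Fin n) k) u) := by
  simp [orbitPoly_eq, Polynomial.eval_prod]

theorem isIntegral_invariants : Algebra.IsIntegral (invariants G) (MvPolynomial (Fin n) k) := by
  refine ⟨fun u => ?_⟩
  have hl : orbitPoly G u ∈ Polynomial.lifts (algebraMap (invariants G) _) :=
    (Polynomial.lifts_iff_coeff_lifts _).mpr fun i => ⟨⟨_, orbitPoly_coeff_mem G u i⟩, rfl⟩
  obtain ⟨p, hp, -, hm⟩ := Polynomial.lifts_and_natDegree_eq_and_monic hl (orbitPoly_monic G u)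
  exact ⟨p, hm, by rw [← Polynomial.eval_map, hp, orbitPoly_eval]⟩

end Orbit

section Integrality

variable {Ω : Type} [Field Ω]

/-- An element of an algebraic extension of the fraction field of a UFD is integral if, locally at
every prime element, some multiple of it is. -/
theorem isIntegral_of_forall_irreducible {B : Type} [CommRing B] [IsDomain B]
    [UniqueFactorizationMonoid B] [Algebra B Ω] [FaithfulSMul B Ω] {z : Ω}
    (H : ∀ p : B, Irreducible p → ∃ b : B, ¬ p ∣ b ∧ IsIntegral B (algebraMap B Ω b * z))
    (hz : IsAlgebraic B z) :
    IsIntegral B z := by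
  let L := FractionRing B
  let : Algebra L Ω := FractionRing.liftAlgebra B Ω
  have hzL : IsIntegral L z := (hz.extendScalars (IsFractionRing.injective B L)).isIntegral
  have hlift : minpoly L z ∈ Polynomial.lifts (algebraMap B L) := by
    rw [Polynomial.lifts_iff_coeff_lifts]
    intro i
    obtain ⟨x, y, hxy, e⟩ := IsFractionRing.exists_reduced_fraction (A := B) ((minpoly L z).coeff i)
    by_cases hy : IsUnit (y : B)
    · obtain ⟨u, hu⟩ := hy
      refine ⟨x * ↑u⁻¹, ?_⟩
      rw [← e, IsLocalization.eq_mk'_iff_mul_eq, ← hu, ← map_mul, mul_assoc, Units.inv_mul, mul_one]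
    exfalso
    obtain ⟨p, hp, hpy⟩ := WfDvdMonoid.exists_irreducible_factor hy (nonZeroDivisors.coe_ne_zero y)
    obtain ⟨b, hpb, hb⟩ := H p hp
    have hb0 : b ≠ 0 := by rintro rfl; exact hpb (dvd_zero p)
    have hb0' : algebraMap B L b ≠ 0 := by simpa using hb0
    have e1 : (minpoly B (algebraMap B Ω b * z)).map (algebraMap B L)
        = (minpoly L z).scaleRoots (algebraMap B L b) := by
      rw [← minpoly.isIntegrallyClosed_eq_field_fractions' L hb,
        ← IsIntegrallyClosed.minpoly_smul hb0' hzL, Algebra.smul_def,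
        ← IsScalarTower.algebraMap_apply]
    have e2 := congrArg (fun q => Polynomial.coeff q i) e1
    simp only [Polynomial.coeff_map, Polynomial.coeff_scaleRoots] at e2
    set m := (minpoly L z).natDegree - i
    set a := (minpoly B (algebraMap B Ω b * z)).coeff i
    have e3 : a * y = x * b ^ m := by
      apply IsFractionRing.injective B L
      rw [map_mul, e2, ← e, map_mul, map_pow, mul_right_comm, IsLocalization.mk'_spec]
    have hpx : p ∣ x := by
      have : p ∣ x * b ^ m := e3 ▸ hpy.mul_left a
      exact (hp.prime.dvd_or_dvd this).resolve_right fun h => hpb (hp.prime.dvd_of_dvd_pow h)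
    exact hp.not_isUnit (hxy hpx hpy)
  obtain ⟨q, hq, -, hm⟩ := Polynomial.lifts_and_natDegree_eq_and_monic hlift (minpoly.monic hzL)
  refine ⟨q, hm, ?_⟩
  rw [IsScalarTower.algebraMap_eq B L Ω, ← Polynomial.eval₂_map, hq]
  exact minpoly.aeval L z

end Integrality

section Derivations

variable {Ω : Type} [Field Ω] [Algebra k Ω]

theorem exists_derivation_extension {B : Type} [CommRing B] [IsDomain B] [CharZero B]
    [Algebra k B] [Algebra B Ω] [IsScalarTower k B Ω] [FaithfulSMul B Ω]
    [Algebra.IsAlgebraic B Ω] (d : Derivation k B Ω) :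
    ∃ D : Derivation k Ω Ω, ∀ b, D (algebraMap B Ω b) = d b := by
  let L := FractionRing B
  let : Algebra L Ω := FractionRing.liftAlgebra B Ω
  have : Algebra.IsAlgebraic L Ω := Algebra.IsAlgebraic.extendScalars (IsFractionRing.injective B L)
  have : CharZero L := charZero_of_injective_algebraMap (IsFractionRing.injective B L)
  have : Algebra.FormallyEtale L Ω := Algebra.FormallyEtale.of_isSeparable L Ω
  have : Algebra.FormallyEtale B L := Algebra.FormallyEtale.of_isLocalization (nonZeroDivisors B)
  have : Algebra.FormallyEtale B Ω := Algebra.FormallyEtale.comp B L Ω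
  let e := KaehlerDifferential.tensorKaehlerEquivOfFormallyEtale k B Ω
  refine ⟨((LinearMap.liftBaseChange Ω d.liftKaehlerDifferential) ∘ₗ
    e.symm.toLinearMap).compDer (KaehlerDifferential.D k Ω), fun b => ?_⟩
  simp [e, KaehlerDifferential.tensorKaehlerEquivOfFormallyEtale_symm_D_algebraMap]

/-- A derivation vanishing on a subring vanishes on elements algebraic over it. -/
theorem derivation_eq_zero_of_isAlgebraic {B : Type} [CommRing B] [IsDomain B] [CharZero B]
    [Algebra k B] [Algebra B Ω] [IsScalarTower k B Ω] [FaithfulSMul B Ω]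
    [Algebra.IsAlgebraic B Ω] {D : Derivation k Ω Ω} (hD : ∀ b, D (algebraMap B Ω b) = 0) :
    D = 0 := by
  let L := FractionRing B
  let : Algebra L Ω := FractionRing.liftAlgebra B Ω
  have : Algebra.IsAlgebraic L Ω := Algebra.IsAlgebraic.extendScalars (IsFractionRing.injective B L)
  have : CharZero L := charZero_of_injective_algebraMap (IsFractionRing.injective B L)
  have : Algebra.FormallyUnramified L Ω := Algebra.FormallyUnramified.of_isSeparable L Ω
  have : Algebra.FormallyUnramified B L :=
    Algebra.FormallyUnramified.of_isLocalization (nonZeroDivisors B)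
  have : Algebra.FormallyUnramified B Ω := Algebra.FormallyUnramified.comp B L Ω
  let D' : Derivation B Ω Ω :=
    { toFun := D
      map_add' := map_add D
      map_smul' := fun b z => by simp [Algebra.smul_def, hD]
      map_one_eq_zero' := D.map_one_eq_zero
      leibniz' := D.leibniz }
  have hD' : D' = 0 := by
    rw [← D'.liftKaehlerDifferential_comp,
      Subsingleton.elim D'.liftKaehlerDifferential 0]
    rfl
  ext z
  exact DFunLike.congr_fun hD' z

end Derivations

section DerivationsOfLinearForms

variable {n : ℕ} {Ω : Type} [Field Ω] [Algebra (MvPolynomial (Fin n) k) Ω]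

theorem isIntegral_orbitPoly_derivative_mul [Algebra k Ω]
    (G : Subgroup (Matrix.GeneralLinearGroup (Fin n) k)) [Fintype G] (δ : Derivation k Ω Ω)
    (hδ : ∀ f ∈ invariants G,
      IsIntegral (MvPolynomial (Fin n) k) (δ (algebraMap (MvPolynomial (Fin n) k) Ω f)))
    (u : MvPolynomial (Fin n) k) :
    IsIntegral (MvPolynomial (Fin n) k)
      (algebraMap (MvPolynomial (Fin n) k) Ω ((orbitPoly G u).derivative.eval u) *
        δ (algebraMap (MvPolynomial (Fin n) k) Ω u)) := by
  set P := orbitPoly G u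
  set a := algebraMap (MvPolynomial (Fin n) k) Ω
  have h0 : ∑ i ∈ P.support, δ (a (P.coeff i) * a u ^ i) = 0 := by
    have h := congrArg (fun x => δ (a x)) (orbitPoly_eval G u)
    simpa only [Polynomial.eval_eq_sum, Polynomial.sum_def, map_sum, map_mul, map_pow, map_zero]
      using h
  have h1 : a (P.derivative.eval u) * δ (a u) =
      ∑ i ∈ P.support, a (P.coeff i) * δ (a u ^ i) := by
    rw [Polynomial.derivative_eval, Polynomial.sum_def, map_sum, Finset.sum_mul]
    refine Finset.sum_congr rfl fun i _ => ?_
    rw [Derivation.leibniz_pow]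
    simp only [map_mul, map_natCast, map_pow, smul_eq_mul, nsmul_eq_mul]
    ring
  have h2 : a (P.derivative.eval u) * δ (a u) = -∑ i ∈ P.support, a u ^ i * δ (a (P.coeff i)) := by
    rw [h1, eq_neg_iff_add_eq_zero, ← Finset.sum_add_distrib, ← h0]
    exact Finset.sum_congr rfl fun i _ => by rw [δ.leibniz, smul_eq_mul, smul_eq_mul]
  rw [h2]
  exact (IsIntegral.sum _ fun i _ => (isIntegral_algebraMap.pow i).mul
    (hδ _ (orbitPoly_coeff_mem G u i))).neg

/-- If `G` contains no reflections, a derivation sending invariants to integral elements sends all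
linear forms to integral elements. -/
theorem isIntegral_derivation_linForm [Infinite k] [Algebra k Ω]
    [IsScalarTower k (MvPolynomial (Fin n) k) Ω]
    [FaithfulSMul (MvPolynomial (Fin n) k) Ω] [Algebra.IsAlgebraic (MvPolynomial (Fin n) k) Ω]
    (G : Subgroup (Matrix.GeneralLinearGroup (Fin n) k)) [Fintype G]
    (hG : ∀ g ∈ G, ¬ IsReflection ((g : Matrix (Fin n) (Fin n) k)))
    (δ : Derivation k Ω Ω)
    (hδ : ∀ f ∈ invariants G,
      IsIntegral (MvPolynomial (Fin n) k) (δ (algebraMap (MvPolynomial (Fin n) k) Ω f)))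
    (v : Fin n → k) :
    IsIntegral (MvPolynomial (Fin n) k)
      (δ (algebraMap (MvPolynomial (Fin n) k) Ω (linForm v))) := by
  classical
  refine isIntegral_of_forall_irreducible (fun p hp => ?_) (Algebra.IsAlgebraic.isAlgebraic _)
  let S : Submodule k (Fin n → k) :=
    { carrier := {v | ∃ b : MvPolynomial (Fin n) k, ¬ p ∣ b ∧
        IsIntegral (MvPolynomial (Fin n) k) (algebraMap _ Ω b * δ (algebraMap _ Ω (linForm v)))}
      zero_mem' := ⟨1, fun h => hp.not_isUnit (isUnit_of_dvd_one h), by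
        rw [map_zero, map_zero, map_zero, mul_zero]
        exact isIntegral_zero⟩
      add_mem' := by
        rintro v w ⟨b, hb, hv⟩ ⟨c, hc, hw⟩
        refine ⟨b * c, fun h => (hp.prime.dvd_or_dvd h).elim hb hc, ?_⟩
        have e : algebraMap _ Ω (b * c) * δ (algebraMap _ Ω (linForm (v + w)))
            = algebraMap _ Ω c * (algebraMap _ Ω b * δ (algebraMap _ Ω (linForm v)))
              + algebraMap _ Ω b * (algebraMap _ Ω c * δ (algebraMap _ Ω (linForm w))) := by
          rw [map_add, map_add, map_add, map_mul]
          ring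
        rw [e]
        exact (isIntegral_algebraMap.mul hv).add (isIntegral_algebraMap.mul hw)
      smul_mem' := by
        rintro c v ⟨b, hb, hv⟩
        refine ⟨b, hb, ?_⟩
        have e : algebraMap (MvPolynomial (Fin n) k) Ω (linForm (c • v))
            = c • algebraMap (MvPolynomial (Fin n) k) Ω (linForm v) := by
          rw [map_smul, Algebra.algebraMap_eq_smul_one, smul_assoc, ← Algebra.algebraMap_eq_smul_one]
        rw [e, δ.map_smul, mul_smul_comm, ← algebraMap_smul (MvPolynomial (Fin n) k) c]
        exact hv.smul _ }
  let U (g : G) : Submodule k (Fin n → k) :=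
    { carrier := {v | p ∣ linForm v - matAct (g : Matrix.GeneralLinearGroup (Fin n) k) (linForm v)}
      zero_mem' := by simp
      add_mem' := fun {v w} hv hw => by
        simpa [add_sub_add_comm] using dvd_add hv hw
      smul_mem' := fun c v hv => by
        rw [Set.mem_ofPred_eq, map_smul, map_smul, ← smul_sub, smul_eq_C_mul]
        exact Dvd.dvd.mul_left hv (C c) }
  suffices S = ⊤ from (this ▸ Submodule.mem_top : v ∈ S)
  let F : Option {g : G // g ≠ 1} → Submodule k (Fin n → k) := fun o => o.elim S fun g => U g
  have hcover : ⋃ o, (F o : Set (Fin n → k)) = Set.univ := by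
    rw [Set.eq_univ_iff_forall]
    intro u
    rw [Set.mem_iUnion]
    by_cases hu : ∃ g : {g : G // g ≠ 1}, u ∈ U g
    · obtain ⟨g, hg⟩ := hu
      exact ⟨some g, hg⟩
    · refine ⟨none, (orbitPoly G (linForm u)).derivative.eval (linForm u), ?_,
        isIntegral_orbitPoly_derivative_mul G δ hδ _⟩
      rw [orbitPoly_derivative_eval, hp.prime.dvd_finsetProd_iff]
      rintro ⟨g, hg, hdvd⟩
      exact hu ⟨⟨g, Finset.ne_of_mem_erase hg⟩, hdvd⟩
  obtain ⟨o, ho⟩ := Subspace.exists_eq_top_of_iUnion_eq_univ hcover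
  match o, ho with
  | none, ho => exact ho
  | some g, ho =>
    exfalso
    have hfin : IsOfFinOrder ((g : G) : Matrix.GeneralLinearGroup (Fin n) k) :=
      Submonoid.isOfFinOrder_coe.mpr (isOfFinOrder_of_finite (g : G))
    obtain ⟨w, hw⟩ := exists_not_dvd_sub_matAct (g := (g : G)) (fun h => g.2 (Subtype.ext h))
      (Units.isOfFinOrder_val.mpr hfin.inv) (hG _ (inv_mem (g : G).2)) hp.not_isUnit
    have hU : U g = ⊤ := ho
    exact hw (hU.symm ▸ Submodule.mem_top : w ∈ U g)

end DerivationsOfLinearForms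

section Euler

variable {n : ℕ}

theorem derivation_sum_apply {B M ι : Type} [CommRing B] [Algebra k B] [AddCommGroup M]
    [Module B M] [Module k M] (s : Finset ι) (D : ι → Derivation k B M) (b : B) :
    (∑ i ∈ s, D i) b = ∑ i ∈ s, D i b := by
  rw [← Derivation.coeFnAddMonoidHom_apply, map_sum, Finset.sum_apply]
  rfl

/-- The Euler derivation of the polynomial ring. -/
def euler : Derivation k (MvPolynomial (Fin n) k) (MvPolynomial (Fin n) k) :=
  ∑ i, (X i : MvPolynomial (Fin n) k) • pderiv i

theorem euler_apply (f : MvPolynomial (Fin n) k) : euler f = ∑ i, X i * pderiv i f := by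
  rw [euler, derivation_sum_apply]
  rfl

theorem euler_of_isHomogeneous {f : MvPolynomial (Fin n) k} {d : ℕ} (hf : f.IsHomogeneous d) :
    euler f = d • f := by
  rw [euler_apply, hf.sum_X_mul_pderiv]

theorem eq_C_of_euler_eq_zero [CharZero k] {f : MvPolynomial (Fin n) k} (hf : euler f = 0) :
    f = C (coeff 0 f) := by
  have hsum : ∑ j ∈ Finset.range (f.totalDegree + 1), j • homogeneousComponent j f = 0 := by
    rw [← hf]
    conv_rhs => rw [← sum_homogeneousComponent f, map_sum]
    exact Finset.sum_congr rfl fun j _ =>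
      (euler_of_isHomogeneous (homogeneousComponent_isHomogeneous j f)).symm
  have hcomp (d : ℕ) (hd : d ≠ 0) : homogeneousComponent d f = 0 := by
    by_cases hdf : f.totalDegree < d
    · exact homogeneousComponent_eq_zero _ _ hdf
    have h := congrArg (homogeneousComponent d) hsum
    have hj (j : ℕ) : homogeneousComponent d (j • homogeneousComponent j f)
        = if d = j then j • homogeneousComponent j f else 0 :=
      homogeneousComponent_of_mem ((homogeneousSubmodule (Fin n) k j).smul_of_tower_mem j
        (homogeneousComponent_isHomogeneous j f))
    simp_rw [map_sum, hj, map_zero] at h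
    rw [Finset.sum_ite_eq, if_pos (by simp; omega)] at h
    exact (smul_eq_zero.mp h).resolve_left hd
  conv_lhs => rw [← sum_homogeneousComponent f]
  rw [Finset.sum_eq_single 0 (fun d _ hd => hcomp d hd) (by simp), homogeneousComponent_zero]

/-- An integral element killed by an extension of the Euler derivation is a scalar. -/
theorem mem_range_algebraMap_of_euler_eq_zero [CharZero k] [IsAlgClosed k] {Ω : Type} [Field Ω]
    [Algebra (MvPolynomial (Fin n) k) Ω] [Algebra k Ω]
    [IsScalarTower k (MvPolynomial (Fin n) k) Ω]
    [FaithfulSMul (MvPolynomial (Fin n) k) Ω]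
    (E : Derivation k Ω Ω)
    (hE : ∀ f, E (algebraMap (MvPolynomial (Fin n) k) Ω f) = algebraMap _ Ω (euler f))
    {z : Ω} (hz : IsIntegral (MvPolynomial (Fin n) k) z) (hEz : E z = 0) :
    z ∈ (algebraMap k Ω).range := by
  set p := minpoly (MvPolynomial (Fin n) k) z with hp
  have hmonic : p.Monic := minpoly.monic hz
  let q : Polynomial (MvPolynomial (Fin n) k) :=
    ∑ i ∈ p.support, Polynomial.monomial i (euler (p.coeff i))
  have hq_coeff (i : ℕ) : q.coeff i = euler (p.coeff i) := by
    simp only [q, Polynomial.finsetSum_coeff, Polynomial.coeff_monomial, Finset.sum_ite_eq']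
    split_ifs with h
    · rfl
    · rw [Polynomial.notMem_support_iff.mp h, map_zero]
  have hq_aeval : Polynomial.aeval z q = 0 := by
    have h := congrArg E (minpoly.aeval (MvPolynomial (Fin n) k) z)
    rw [← hp, map_zero, Polynomial.aeval_eq_sum_range, map_sum] at h
    rw [Polynomial.aeval_eq_sum_range' (n := p.natDegree + 1), ← h]
    · refine Finset.sum_congr rfl fun i _ => ?_
      rw [Algebra.smul_def, Algebra.smul_def, E.leibniz, E.leibniz_pow, hEz, hE, hq_coeff]
      simp [mul_comm]
    · refine Nat.lt_succ_of_le (Polynomial.natDegree_le_iff_coeff_eq_zero.mpr fun i hi => ?_)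
      rw [hq_coeff, Polynomial.coeff_eq_zero_of_natDegree_lt hi, map_zero]
  have hq0 : q = 0 := by
    by_contra hne
    have h1 := minpoly.IsIntegrallyClosed.degree_le_of_ne_zero hne hq_aeval
    refine absurd h1 (not_le.mpr ?_)
    rw [← hp, Polynomial.degree_eq_natDegree hmonic.ne_zero, Polynomial.degree_lt_iff_coeff_zero]
    intro i hi
    rw [hq_coeff]
    rcases hi.eq_or_lt with rfl | hi
    · rw [hmonic.coeff_natDegree, Derivation.map_one_eq_zero]
    · rw [Polynomial.coeff_eq_zero_of_natDegree_lt hi, map_zero]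
  have hlift : p ∈ Polynomial.lifts (algebraMap k (MvPolynomial (Fin n) k)) := by
    refine (Polynomial.lifts_iff_coeff_lifts _).mpr fun i => ⟨coeff 0 (p.coeff i), ?_⟩
    exact (eq_C_of_euler_eq_zero (by rw [← hq_coeff, hq0, Polynomial.coeff_zero])).symm
  obtain ⟨r, hr, -, hrm⟩ := Polynomial.lifts_and_natDegree_eq_and_monic hlift hmonic
  have hzk : IsIntegral k z := ⟨r, hrm, by
    rw [IsScalarTower.algebraMap_eq k (MvPolynomial (Fin n) k) Ω, ← Polynomial.eval₂_map, hr]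
    exact minpoly.aeval _ z⟩
  exact minpoly.mem_range_of_degree_eq_one k z
    (IsAlgClosed.degree_eq_one_of_irreducible k (minpoly.irreducible hzk))

end Euler

section GradedAutomorphism

variable {n : ℕ}

theorem derivation_eq_zero_of_X [CharZero k] {Ω : Type} [Field Ω]
    [Algebra (MvPolynomial (Fin n) k) Ω] [Algebra k Ω]
    [IsScalarTower k (MvPolynomial (Fin n) k) Ω]
    [FaithfulSMul (MvPolynomial (Fin n) k) Ω] [Algebra.IsAlgebraic (MvPolynomial (Fin n) k) Ω]
    {D : Derivation k Ω Ω} (hD : ∀ i, D (algebraMap (MvPolynomial (Fin n) k) Ω (X i)) = 0) :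
    D = 0 := by
  refine derivation_eq_zero_of_isAlgebraic (B := MvPolynomial (Fin n) k) fun b => ?_
  have : D.compAlgebraMap (MvPolynomial (Fin n) k) = 0 := MvPolynomial.derivation_ext hD
  exact DFunLike.congr_fun this b

/-- Conjugation of a derivation by an automorphism. -/
def conjDerivation {Ω : Type} [Field Ω] [Algebra k Ω] (τ : Ω ≃ₐ[k] Ω) (D : Derivation k Ω Ω) :
    Derivation k Ω Ω :=
  Derivation.mk' (τ.symm.toLinearMap ∘ₗ D.toLinearMap ∘ₗ τ.toLinearMap) fun x y => by
    simp

theorem conjDerivation_apply {Ω : Type} [Field Ω] [Algebra k Ω] (τ : Ω ≃ₐ[k] Ω)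
    (D : Derivation k Ω Ω) (z : Ω) : conjDerivation τ D z = τ.symm (D (τ z)) := rfl

theorem exists_matAct_eq_of_isAlgClosed [CharZero k] [IsAlgClosed k]
    (Ω : Type) [Field Ω] [IsAlgClosed Ω]
    [Algebra (MvPolynomial (Fin n) k) Ω] [Algebra k Ω]
    [IsScalarTower k (MvPolynomial (Fin n) k) Ω]
    [FaithfulSMul (MvPolynomial (Fin n) k) Ω] [Algebra.IsAlgebraic (MvPolynomial (Fin n) k) Ω]
    (G : Subgroup (Matrix.GeneralLinearGroup (Fin n) k)) [Fintype G]
    (hG : ∀ g ∈ G, ¬ IsReflection ((g : Matrix (Fin n) (Fin n) k)))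
    (σ : invariants G ≃ₐ[k] invariants G)
    (hσ : ∀ (f : invariants G) (d : ℕ), (f : MvPolynomial (Fin n) k).IsHomogeneous d →
      (σ f : MvPolynomial (Fin n) k).IsHomogeneous d) :
    ∃ g : Matrix.GeneralLinearGroup (Fin n) k, ∀ f : invariants G,
      (σ f : MvPolynomial (Fin n) k) = matAct g (f : MvPolynomial (Fin n) k) := by
  have hInt := isIntegral_invariants G
  set a := algebraMap (MvPolynomial (Fin n) k) Ω with ha
  have ha_inj : Function.Injective a := FaithfulSMul.algebraMap_injective _ _
  have : Algebra.IsAlgebraic (invariants G) Ω :=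
    Algebra.IsAlgebraic.trans (invariants G) (MvPolynomial (Fin n) k) Ω
  have : FaithfulSMul (invariants G) Ω := (faithfulSMul_iff_algebraMap_injective _ _).mpr
    (ha_inj.comp Subtype.val_injective)
  have : Module.IsTorsionFree (invariants G) Ω := Module.isTorsionFree_iff_faithfulSMul.mpr this
  have : IsAlgClosure (invariants G) Ω := ⟨inferInstance, inferInstance⟩
  let τ₀ : Ω ≃+* Ω := IsAlgClosure.equivOfEquiv Ω Ω (σ : invariants G ≃+* invariants G)
  have hτ₀ (f : invariants G) : τ₀ (a f) = a (σ f) :=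
    IsAlgClosure.equivOfEquiv_algebraMap Ω Ω (σ : invariants G ≃+* invariants G) f
  let τ : Ω ≃ₐ[k] Ω := AlgEquiv.ofRingEquiv (f := τ₀) fun c => by
    have h := hτ₀ (algebraMap k _ c)
    rwa [AlgEquiv.commutes, Subalgebra.coe_algebraMap, ha, ← IsScalarTower.algebraMap_apply] at h
  have hτ (f : invariants G) : τ (a f) = a (σ f) := hτ₀ f
  have hτ_symm (f : invariants G) : τ.symm (a f) = a (σ.symm f) := by
    rw [AlgEquiv.symm_apply_eq, hτ, AlgEquiv.apply_symm_apply]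
  have hτ_int {z : Ω} (hz : IsIntegral (MvPolynomial (Fin n) k) z) :
      IsIntegral (MvPolynomial (Fin n) k) (τ z) :=
    ((isIntegral_trans (R := invariants G) z hz).map_of_comp_eq
      (σ : invariants G →+* invariants G) (τ : Ω →+* Ω)
      (RingHom.ext fun f => (hτ f).symm)).tower_top
  have hτ_symm_int {z : Ω} (hz : IsIntegral (MvPolynomial (Fin n) k) z) :
      IsIntegral (MvPolynomial (Fin n) k) (τ.symm z) :=
    ((isIntegral_trans (R := invariants G) z hz).map_of_comp_eq
      (σ.symm : invariants G →+* invariants G) (τ.symm : Ω →+* Ω)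
      (RingHom.ext fun f => (hτ_symm f).symm)).tower_top
  choose D hD using fun i : Fin n => exists_derivation_extension (Ω := Ω)
    ((Algebra.linearMap (MvPolynomial (Fin n) k) Ω).compDer (pderiv (R := k) i))
  replace hD (i : Fin n) (f : MvPolynomial (Fin n) k) : D i (a f) = a (pderiv i f) := hD i f
  have hD_int (i : Fin n) (v : Fin n → k) :
      IsIntegral (MvPolynomial (Fin n) k) (D i (τ (a (linForm v)))) := by
    rw [← τ.apply_symm_apply (D i (τ (a (linForm v))))]
    refine hτ_int (isIntegral_derivation_linForm G hG (conjDerivation τ (D i)) (fun f hf => ?_) v)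
    rw [conjDerivation_apply, ← ha, hτ ⟨f, hf⟩, hD]
    exact hτ_symm_int isIntegral_algebraMap
  let E : Derivation k Ω Ω := ∑ i, a (X i) • D i
  have hE_apply (z : Ω) : E z = ∑ i, a (X i) * D i z := by
    simp only [E]
    rw [derivation_sum_apply]
    rfl
  have hE (f : MvPolynomial (Fin n) k) : E (a f) = a (euler f) := by
    rw [hE_apply, euler_apply, map_sum]
    simp_rw [map_mul, hD]
  have hE_homog (f : MvPolynomial (Fin n) k) (d : ℕ) (hf : f.IsHomogeneous d) :
      E (a f) = d • a f := by
    rw [hE, euler_of_isHomogeneous hf, map_nsmul]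
  have hEτ (z : Ω) : E (τ z) = τ (E z) := by
    have h : conjDerivation τ E - E = 0 := by
      refine derivation_eq_zero_of_isAlgebraic (B := invariants G) fun f => ?_
      rw [Derivation.sub_apply, sub_eq_zero, conjDerivation_apply, AlgEquiv.symm_apply_eq]
      let c (j : ℕ) : invariants G :=
        ⟨homogeneousComponent j (f : MvPolynomial (Fin n) k),
          homogeneousComponent_mem_invariants f.2 j⟩
      have hf : f = ∑ j ∈ Finset.range ((f : MvPolynomial (Fin n) k).totalDegree + 1), c j := by
        apply Subtype.ext
        rw [AddSubmonoidClass.coe_finsetSum]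
        exact (sum_homogeneousComponent _).symm
      rw [hf]
      simp only [map_sum]
      refine Finset.sum_congr rfl fun j _ => ?_
      have hj : (c j : MvPolynomial (Fin n) k).IsHomogeneous j :=
        homogeneousComponent_isHomogeneous _ _
      change E (τ (a (c j))) = τ (E (a (c j)))
      rw [hτ, hE_homog _ j (hσ _ j hj), hE_homog _ j hj, map_nsmul, hτ]
    have h' := DFunLike.congr_fun h z
    rwa [Derivation.sub_apply, Derivation.zero_apply, sub_eq_zero, conjDerivation_apply,
      AlgEquiv.symm_apply_eq] at h'
  have hED (i : Fin n) (z : Ω) : E (D i z) = D i (E z) - D i z := by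
    have h : ⁅E, D i⁆ + D i = 0 := by
      refine derivation_eq_zero_of_X (n := n) fun j => ?_
      have hX : E (a (X j)) = a (X j) := by rw [hE_homog _ 1 (isHomogeneous_X k j), one_smul]
      rw [Derivation.add_apply, Derivation.commutator_apply, ← ha, hX, sub_add_cancel, hD, hE,
        pderiv_X, Pi.single_apply]
      split_ifs <;> simp
    have h' := DFunLike.congr_fun h z
    rw [Derivation.add_apply, Derivation.commutator_apply, Derivation.zero_apply] at h'
    linear_combination h'
  have hE_lin (v : Fin n → k) : E (τ (a (linForm v))) = τ (a (linForm v)) := by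
    rw [hEτ, hE_homog _ 1 (isHomogeneous_linForm v), one_smul]
  have hscalar (j i : Fin n) : ∃ c : k, algebraMap k Ω c = D i (τ (a (X j))) := by
    refine mem_range_algebraMap_of_euler_eq_zero E hE (z := D i (τ (a (X j)))) ?_ ?_
    · rw [← linForm_single]
      exact hD_int i _
    · rw [hED, ← linForm_single, hE_lin, sub_self]
  choose M hM using hscalar
  have hτX (j : Fin n) : τ (a (X j)) = a (linForm (M j)) := by
    rw [← linForm_single, ← hE_lin, hE_apply, linForm_apply (M j), map_sum]
    refine Finset.sum_congr rfl fun i _ => ?_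
    rw [linForm_single, ← hM, smul_eq_C_mul, map_mul, mul_comm, ← algebraMap_eq, ha,
      ← IsScalarTower.algebraMap_apply]
  have hτ_lin (v : Fin n → k) : τ (a (linForm v)) = a (linForm (Matrix.vecMul v (Matrix.of M))) := by
    let α := IsScalarTower.toAlgHom k (MvPolynomial (Fin n) k) Ω
    have hα (j : Fin n) : τ (α (X j)) = α (linForm (M j)) := hτX j
    change τ (α (linForm v)) = α _
    have h : Matrix.vecMul v (Matrix.of M) = ∑ j, v j • M j := Matrix.vecMul_eq_sum _ _
    rw [linForm_apply, h]
    simp only [map_sum, map_smul, hα]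
  have hunit : IsUnit (Matrix.of M) := by
    rw [← Matrix.vecMul_injective_iff_isUnit]
    intro v w hvw
    refine linForm_injective (ha_inj (τ.injective ?_))
    rw [hτ_lin, hτ_lin]
    exact congrArg (fun x => a (linForm x)) hvw
  obtain ⟨u, hu⟩ := hunit
  refine ⟨u⁻¹, fun f => ha_inj ?_⟩
  rw [← hτ]
  have key : (τ : Ω →ₐ[k] Ω).comp (IsScalarTower.toAlgHom k (MvPolynomial (Fin n) k) Ω) =
      (IsScalarTower.toAlgHom k (MvPolynomial (Fin n) k) Ω).comp (matAct u⁻¹) := by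
    refine MvPolynomial.algHom_ext fun j => ?_
    rw [AlgHom.comp_apply, AlgHom.comp_apply, matAct_X, inv_inv, hu]
    exact hτX j
  exact DFunLike.congr_fun key (f : MvPolynomial (Fin n) k)

end GradedAutomorphism

section Lifting

variable {n : ℕ} [CharZero k]

/-- An element of `GL(V)` acting trivially on the invariants of the finite group `G` lies in `G`. -/
theorem mem_of_forall_matAct_eq (G : Subgroup (Matrix.GeneralLinearGroup (Fin n) k)) [Fintype G]
    {g : Matrix.GeneralLinearGroup (Fin n) k} (hg : ∀ f ∈ invariants G, matAct g f = f) :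
    g ∈ G := by
  have hprod (v : Fin n → k) : ∃ h : G, matAct g (linForm v) =
      matAct (h : Matrix.GeneralLinearGroup (Fin n) k) (linForm v) := by
    have hmap : (orbitPoly G (linForm v)).map (matAct g : _ →+* _) = orbitPoly G (linForm v) :=
      Polynomial.ext fun i => by
        rw [Polynomial.coeff_map]
        exact hg _ (orbitPoly_coeff_mem G _ i)
    have h0 : (orbitPoly G (linForm v)).eval (matAct g (linForm v)) = 0 := by
      have h := Polynomial.eval₂_hom (p := orbitPoly G (linForm v))
        (matAct g : MvPolynomial (Fin n) k →+* MvPolynomial (Fin n) k) (linForm v)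
      rw [← Polynomial.eval_map, hmap, orbitPoly_eval, map_zero] at h
      exact h
    rw [orbitPoly, Polynomial.eval_prod, Finset.prod_eq_zero_iff] at h0
    obtain ⟨h, -, hh⟩ := h0
    exact ⟨h, by simpa [sub_eq_zero] using hh⟩
  let K (h : G) : Submodule k (Fin n → k) := LinearMap.eqLocus
    ((matAct g).toLinearMap ∘ₗ linForm)
    ((matAct (h : Matrix.GeneralLinearGroup (Fin n) k)).toLinearMap ∘ₗ linForm)
  obtain ⟨h, hh⟩ := Subspace.exists_eq_top_of_iUnion_eq_univ (p := K)
    (Set.eq_univ_of_forall fun v => Set.mem_iUnion.mpr (hprod v))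
  have hgh : g = h := eq_of_matAct_linForm_eq fun v => by
    have hv : v ∈ K h := hh ▸ Submodule.mem_top
    exact hv
  exact hgh ▸ h.2

/-- Every graded automorphism of the invariants of a finite group without reflections is induced
by an element of `GL(V)`. -/
theorem exists_matAct_eq [IsAlgClosed k]
    (G : Subgroup (Matrix.GeneralLinearGroup (Fin n) k)) [Fintype G]
    (hG : ∀ g ∈ G, ¬ IsReflection ((g : Matrix (Fin n) (Fin n) k)))
    (σ : invariants G ≃ₐ[k] invariants G)
    (hσ : ∀ (f : invariants G) (d : ℕ), (f : MvPolynomial (Fin n) k).IsHomogeneous d →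
      (σ f : MvPolynomial (Fin n) k).IsHomogeneous d) :
    ∃ g : Matrix.GeneralLinearGroup (Fin n) k, ∀ f : invariants G,
      (σ f : MvPolynomial (Fin n) k) = matAct g (f : MvPolynomial (Fin n) k) :=
  have : Algebra.IsAlgebraic (MvPolynomial (Fin n) k)
      (AlgebraicClosure (FractionRing (MvPolynomial (Fin n) k))) :=
    (IsFractionRing.comap_isAlgebraic_iff (K := FractionRing (MvPolynomial (Fin n) k))).mpr
      inferInstance
  have : FaithfulSMul (MvPolynomial (Fin n) k)
      (AlgebraicClosure (FractionRing (MvPolynomial (Fin n) k))) :=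
    FaithfulSMul.trans _ (FractionRing (MvPolynomial (Fin n) k)) _
  exists_matAct_eq_of_isAlgClosed (AlgebraicClosure (FractionRing (MvPolynomial (Fin n) k)))
    G hG σ hσ

/-- The subgroup of `GL(V)` of the elements which act on the invariants of `G` as some element
of `W` does. -/
def liftSubgroup (G : Subgroup (Matrix.GeneralLinearGroup (Fin n) k)) {W : Type} [Group W]
    (act : W →* (invariants G ≃ₐ[k] invariants G)) :
    Subgroup (Matrix.GeneralLinearGroup (Fin n) k) where
  carrier := {g | ∃ w, ∀ f : invariants G,
    (act w f : MvPolynomial (Fin n) k) = matAct g (f : MvPolynomial (Fin n) k)}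
  one_mem' := ⟨1, fun f => by rw [map_one, matAct_one]; rfl⟩
  mul_mem' := fun {a b} ⟨v, hv⟩ ⟨w, hw⟩ => ⟨v * w, fun f => by
    rw [map_mul, matAct_mul, ← hw, ← hv]; rfl⟩
  inv_mem' := fun {a} ⟨w, hw⟩ => ⟨w⁻¹, fun f => by
    have h := hw (act w⁻¹ f)
    rw [← AlgEquiv.mul_apply, ← map_mul, mul_inv_cancel, map_one, AlgEquiv.one_apply] at h
    rw [h, ← matAct_mul, inv_mul_cancel, matAct_one, AlgHom.id_apply]⟩

end Lifting
/-- let `k` be algebraically closed of characteristic zero, `G` a finite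
subgroup of `GL(Vt)` containing no reflection, and `W` a finite group acting faithfully
on `k[Vt]^G` by graded `k`-algebra automorphisms. Then there is a subgroup `Wt` of
`GL(Vt)` containing `G` as a normal subgroup together with an isomorphism
`Wt/G ≅ W` (a surjection `φ : Wt → W` with kernel `G`) carrying the natural action of
`Wt/G` on `k[Vt]^G` to the given action of `W`. -/
theorem statement19 {k : Type} [Field k] [CharZero k] [IsAlgClosed k] {n : ℕ}
    (G : Subgroup (Matrix.GeneralLinearGroup (Fin n) k))
    (hGfin : (G : Set (Matrix.GeneralLinearGroup (Fin n) k)).Finite)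
    (hnorefl : ∀ g ∈ G, ¬ IsReflection ((g : Matrix (Fin n) (Fin n) k)))
    (W : Type) [Group W] [Finite W]
    (act : W →* (↥(invariants G) ≃ₐ[k] ↥(invariants G)))
    (hfaithful : Function.Injective act)
    (hgraded : ∀ (w : W) (f : ↥(invariants G)) (dg : ℕ),
      ((f : MvPolynomial (Fin n) k)).IsHomogeneous dg →
      ((act w f : ↥(invariants G)) : MvPolynomial (Fin n) k).IsHomogeneous dg) :
    ∃ Wt : Subgroup (Matrix.GeneralLinearGroup (Fin n) k),
      G ≤ Wt ∧ (∀ w ∈ Wt, ∀ g ∈ G, w * g * w⁻¹ ∈ G) ∧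
      ∃ φ : ↥Wt →* W,
        Function.Surjective φ ∧
        (∀ u : ↥Wt, φ u = 1 ↔ (u : Matrix.GeneralLinearGroup (Fin n) k) ∈ G) ∧
        (∀ (u : ↥Wt) (f : ↥(invariants G)),
          ((act (φ u) f : ↥(invariants G)) : MvPolynomial (Fin n) k)
            = matAct (u : Matrix.GeneralLinearGroup (Fin n) k)
                (f : MvPolynomial (Fin n) k)) := by
  have : Fintype G := hGfin.fintype
  have huniq {g : Matrix.GeneralLinearGroup (Fin n) k} {v w : W}
      (hv : ∀ f : invariants G, (act v f : MvPolynomial (Fin n) k) = matAct g f)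
      (hw : ∀ f : invariants G, (act w f : MvPolynomial (Fin n) k) = matAct g f) : v = w :=
    hfaithful (AlgEquiv.ext fun f => Subtype.ext ((hv f).trans (hw f).symm))
  have hone {g : Matrix.GeneralLinearGroup (Fin n) k} (hg : g ∈ G) (f : invariants G) :
      (act 1 f : MvPolynomial (Fin n) k) = matAct g f := by
    rw [map_one, f.2 g hg]; rfl
  refine ⟨liftSubgroup G act, fun g hg => ⟨1, hone hg⟩, ?_, ?_⟩
  · rintro u hu g hg
    refine mem_of_forall_matAct_eq G fun f hf => ?_
    obtain ⟨w, hw⟩ := inv_mem hu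
    have hf' := (act w ⟨f, hf⟩).2 g hg
    rw [hw] at hf'
    rw [matAct_mul, matAct_mul, hf', ← matAct_mul, mul_inv_cancel, matAct_one, AlgHom.id_apply]
  · choose φ hφ using fun u : liftSubgroup G act => u.2
    refine ⟨MonoidHom.mk' φ fun a b => huniq (hφ (a * b)) fun f => ?_, fun w => ?_, fun u =>
      ⟨fun h => mem_of_forall_matAct_eq G fun f hf => ?_, fun h => huniq (hφ u) (hone h)⟩, hφ⟩
    · rw [map_mul, Subgroup.coe_mul, matAct_mul, ← hφ b, ← hφ a]; rfl
    · obtain ⟨g, hg⟩ := exists_matAct_eq G hnorefl (act w) (hgraded w)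
      exact ⟨⟨g, w, hg⟩, huniq (hφ ⟨g, w, hg⟩) hg⟩
    · have h' := hφ u ⟨f, hf⟩
      rw [show φ u = 1 from h, map_one] at h'
      exact h'.symm

end ReflQuot
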